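/- Let P_n = p_1·p_2·⋯·p_n be the product of the first n primes. Then lim_{n→∞} P_n·φ₂(P_n)/φ(P_n)² = 2C₂ and lim_{n→∞} φ₂(P_n²)/φ(P_n)² = 2C₂. -/

import Mathlib

open Filter

/-- The modified totient function `φ₂`. -/
def phi2 (n : ℕ) : ℕ :=
  ((Finset.Icc 1 n).filter (fun a => Nat.gcd a n = 1 ∧ Nat.gcd (a + 2) n = 1)).card

/-- The twin prime constant `C₂ = ∏_{p odd prime} p(p-2)/(p-1)²`. -/
noncomputable def C2 : ℝ :=
  ∏' p : {p : ℕ // p.Prime ∧ p ≠ 2}, ((p : ℕ) : ℝ) * (((p : ℕ) : ℝ) - 2) / (((p : ℕ) : ℝ) - 1) ^ 2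

/-- `P n`, the product of the first `n` primes. -/
noncomputable def primorialN (n : ℕ) : ℕ := ∏ i ∈ Finset.range n, Nat.nth Nat.Prime i

theorem count_mul_of_periodic {a : ℕ} {p : ℕ → Prop} [DecidablePred p]
    (hp : Function.Periodic p a) (k : ℕ) : Nat.count p (k * a) = k * Nat.count p a := by
  induction k with
  | zero => simp
  | succ k ih =>
    have h : (fun j => p (k * a + j)) = p := by
      funext j
      rw [add_comm]
      exact hp.nat_mul k j
    rw [Nat.succ_mul, Nat.count_add, ih, Nat.succ_mul]
    simp only [h]

theorem periodic_coprime_and_coprime_add_two (n : ℕ) :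
    Function.Periodic (fun a => Nat.gcd a n = 1 ∧ Nat.gcd (a + 2) n = 1) n := by
  intro a
  simp [add_right_comm a n 2]

theorem phi2_eq_count (n : ℕ) :
    phi2 n = Nat.count (fun a => Nat.gcd a n = 1 ∧ Nat.gcd (a + 2) n = 1) n := by
  rw [← Nat.filter_Ico_card_eq_of_periodic 1 n _ (periodic_coprime_and_coprime_add_two n), phi2]
  congr 2
  ext a
  simp only [Finset.mem_Icc, Finset.mem_Ico]
  omega

theorem phi2_sq (n : ℕ) : phi2 (n ^ 2) = n * phi2 n := by
  have h (a : ℕ) : Nat.gcd a (n ^ 2) = 1 ↔ Nat.gcd a n = 1 :=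
    Nat.coprime_pow_right_iff two_pos a n
  rw [phi2_eq_count n, ← count_mul_of_periodic (periodic_coprime_and_coprime_add_two n),
    phi2_eq_count]
  simp only [h]
  rw [sq]

theorem phi2_eq_card_zmod (n : ℕ) [NeZero n] :
    phi2 n = Nat.card {x : ZMod n // IsUnit x ∧ IsUnit (x + 2)} := by
  classical
  rw [phi2_eq_count, Nat.count_eq_card_filter_range, Nat.card_eq_fintype_card,
    Fintype.card_subtype]
  refine Finset.card_bij (fun a _ => (a : ZMod n)) ?_ ?_ ?_
  · intro a ha
    simp only [Finset.mem_filter, Finset.mem_range, Finset.mem_univ, true_and] at ha ⊢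
    have h := (ZMod.isUnit_iff_coprime (a + 2) n).2 ha.2.2
    push_cast at h
    exact ⟨(ZMod.isUnit_iff_coprime a n).2 ha.2.1, h⟩
  · intro a ha b hb hab
    simp only [Finset.mem_filter, Finset.mem_range] at ha hb
    exact Nat.ModEq.eq_of_lt_of_lt ((ZMod.natCast_eq_natCast_iff a b n).1 hab) ha.1 hb.1
  · intro x hx
    simp only [Finset.mem_filter, Finset.mem_univ, true_and] at hx
    refine ⟨x.val, ?_, ZMod.natCast_zmod_val x⟩
    simp only [Finset.mem_filter, Finset.mem_range]
    refine ⟨ZMod.val_lt x, (ZMod.isUnit_iff_coprime _ n).1 ?_, (ZMod.isUnit_iff_coprime _ n).1 ?_⟩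
    · simpa using hx.1
    · simpa using hx.2

theorem phi2_mul {m n : ℕ} [NeZero m] [NeZero n] (h : m.Coprime n) :
    phi2 (m * n) = phi2 m * phi2 n := by
  rw [phi2_eq_card_zmod, phi2_eq_card_zmod, phi2_eq_card_zmod, ← Nat.card_prod]
  let e := ZMod.chineseRemainder h
  refine Nat.card_congr ((e.toEquiv.subtypeEquiv (q := fun y =>
    (IsUnit y.1 ∧ IsUnit (y.1 + 2)) ∧ (IsUnit y.2 ∧ IsUnit (y.2 + 2))) ?_).trans
      (Equiv.subtypeProdEquivProd (p := fun a => IsUnit a ∧ IsUnit (a + 2))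
        (q := fun b => IsUnit b ∧ IsUnit (b + 2))))
  intro x
  have hx : IsUnit (x + 2) ↔ IsUnit (e x + 2) := by
    rw [← isUnit_map_iff e (x + 2), map_add, map_ofNat]
  rw [hx, ← isUnit_map_iff e x, Prod.isUnit_iff, Prod.isUnit_iff]
  simp only [Prod.fst_add, Prod.snd_add, Prod.fst_ofNat, Prod.snd_ofNat]
  change _ ↔ (IsUnit (e x).1 ∧ IsUnit ((e x).1 + 2)) ∧ (IsUnit (e x).2 ∧ IsUnit ((e x).2 + 2))
  tauto

theorem phi2_two : phi2 2 = 1 := by decide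

theorem phi2_prime {p : ℕ} (hp : p.Prime) (hp2 : p ≠ 2) : phi2 p = p - 2 := by
  classical
  have := Fact.mk hp
  have h2 : (0 : ZMod p) ≠ -2 := by
    intro h
    have h' : ((2 : ℕ) : ZMod p) = 0 := by
      simpa using (neg_eq_zero.1 h.symm)
    rw [ZMod.natCast_eq_zero_iff] at h'
    exact hp2 ((Nat.prime_dvd_prime_iff_eq hp Nat.prime_two).1 h')
  have hset : (Finset.univ.filter fun x : ZMod p => IsUnit x ∧ IsUnit (x + 2)) = {0, -2}ᶜ := by
    ext x
    simp [isUnit_iff_ne_zero, add_eq_zero_iff_eq_neg]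
  rw [phi2_eq_card_zmod, Nat.card_eq_fintype_card, Fintype.card_subtype, hset,
    Finset.card_compl, Finset.card_pair h2, ZMod.card]

theorem primorialN_succ (n : ℕ) :
    primorialN (n + 1) = primorialN n * Nat.nth Nat.Prime n :=
  Finset.prod_range_succ _ _

theorem primorialN_pos (n : ℕ) : 0 < primorialN n :=
  Finset.prod_pos fun i _ => (Nat.prime_nth_prime i).pos

theorem coprime_primorialN_nth_prime (n : ℕ) :
    (primorialN n).Coprime (Nat.nth Nat.Prime n) := by
  refine Nat.Coprime.prod_left fun i hi => ?_
  rw [Nat.coprime_primes (Nat.prime_nth_prime i) (Nat.prime_nth_prime n)]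
  exact (Nat.nth_strictMono Nat.infinite_setOfPred_prime (Finset.mem_range.1 hi)).ne

theorem two_lt_nth_prime_succ (i : ℕ) : 2 < Nat.nth Nat.Prime (i + 1) := by
  have := Nat.add_two_le_nth_prime (i + 1)
  omega

/-- The Euler factor `p(p-2)/(p-1)²` of the twin prime constant. -/
noncomputable def twinFactor (p : ℕ) : ℝ := (p : ℝ) * ((p : ℝ) - 2) / ((p : ℝ) - 1) ^ 2

theorem primorialN_ratio_succ (n : ℕ) :
    (primorialN (n + 1) : ℝ) * (phi2 (primorialN (n + 1)) : ℝ) /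
        (Nat.totient (primorialN (n + 1)) : ℝ) ^ 2 =
      2 * ∏ i ∈ Finset.range n, twinFactor (Nat.nth Nat.Prime (i + 1)) := by
  induction n with
  | zero => simp [primorialN, phi2_two]
  | succ n ih =>
    have hp := Nat.prime_nth_prime (n + 1)
    have h2 := two_lt_nth_prime_succ n
    have hc := coprime_primorialN_nth_prime (n + 1)
    have : NeZero (primorialN (n + 1)) := ⟨(primorialN_pos _).ne'⟩
    have : NeZero (Nat.nth Nat.Prime (n + 1)) := ⟨hp.ne_zero⟩
    rw [Finset.prod_range_succ, ← mul_assoc, ← ih, primorialN_succ (n + 1), phi2_mul hc,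
      phi2_prime hp h2.ne', Nat.totient_mul hc, Nat.totient_prime hp, twinFactor]
    push_cast [Nat.cast_sub h2.le, Nat.cast_sub hp.one_le]
    rw [div_mul_div_comm, mul_pow]
    congr 1
    ring

theorem multipliable_twinFactor_nth_prime :
    Multipliable fun i => twinFactor (Nat.nth Nat.Prime (i + 1)) := by
  have hf (i : ℕ) : twinFactor (Nat.nth Nat.Prime (i + 1)) =
      1 + -(1 / ((Nat.nth Nat.Prime (i + 1) : ℝ) - 1) ^ 2) := by
    have h : (2 : ℝ) < Nat.nth Nat.Prime (i + 1) := by exact_mod_cast two_lt_nth_prime_succ i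
    have h' : (Nat.nth Nat.Prime (i + 1) : ℝ) - 1 ≠ 0 := by linarith
    rw [twinFactor]
    field_simp
    ring
  simp only [hf]
  refine Real.multipliable_one_add_of_summable (Summable.neg ?_)
  refine Summable.of_nonneg_of_le (fun i => by positivity) (fun i => ?_)
    ((summable_nat_add_iff 1).2 (Real.summable_one_div_nat_pow.2 one_lt_two))
  have h : ((i + 1 + 2 : ℕ) : ℝ) ≤ Nat.nth Nat.Prime (i + 1) := by
    exact_mod_cast Nat.add_two_le_nth_prime (i + 1)
  push_cast at h ⊢
  gcongr
  linarith

/-- The enumeration of the odd primes in increasing order. -/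
noncomputable def oddPrimeEquiv : ℕ ≃ {p : ℕ // p.Prime ∧ p ≠ 2} :=
  Equiv.ofBijective
    (fun i => ⟨Nat.nth Nat.Prime (i + 1), Nat.prime_nth_prime _, (two_lt_nth_prime_succ i).ne'⟩) <| by
    refine ⟨fun i j hij => ?_, fun ⟨p, hp, hp2⟩ => ?_⟩
    · exact Nat.succ_injective
        (Nat.nth_injective Nat.infinite_setOfPred_prime (Subtype.ext_iff.1 hij))
    · obtain ⟨k, hk⟩ : ∃ k, Nat.nth Nat.Prime k = p := ⟨_, Nat.nth_count hp⟩
      cases k with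
      | zero => exact absurd (hk.symm.trans Nat.nth_prime_zero_eq_two) hp2
      | succ k => exact ⟨k, Subtype.ext hk⟩

theorem tprod_twinFactor_nth_prime :
    ∏' i, twinFactor (Nat.nth Nat.Prime (i + 1)) = C2 :=
  oddPrimeEquiv.tprod_eq fun p => twinFactor p

theorem tendsto_primorialN_ratio :
    Tendsto (fun n : ℕ =>
        (primorialN n : ℝ) * (phi2 (primorialN n) : ℝ) / (Nat.totient (primorialN n) : ℝ) ^ 2)
      atTop (nhds (2 * C2)) := by
  rw [← tendsto_add_atTop_iff_nat 1]
  simp only [primorialN_ratio_succ]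
  rw [← tprod_twinFactor_nth_prime]
  exact multipliable_twinFactor_nth_prime.tendsto_prod_tprod_nat.const_mul 2

/-- `lim_{n→∞} P_n φ₂(P_n)/φ(P_n)² = 2C₂` and
`lim_{n→∞} φ₂(P_n²)/φ(P_n)² = 2C₂`. -/
theorem twin_prime_constant_primorial_limits :
    Tendsto (fun n : ℕ =>
        (primorialN n : ℝ) * (phi2 (primorialN n) : ℝ) / (Nat.totient (primorialN n) : ℝ) ^ 2)
      atTop (nhds (2 * C2)) ∧
    Tendsto (fun n : ℕ =>
        (phi2 ((primorialN n) ^ 2) : ℝ) / (Nat.totient (primorialN n) : ℝ) ^ 2)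
      atTop (nhds (2 * C2)) := by
  refine ⟨tendsto_primorialN_ratio, tendsto_primorialN_ratio.congr fun n => ?_⟩
  rw [phi2_sq, Nat.cast_mul]
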